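/- Let Δ = Δ_0 + Δ_1 + ⋯ + Δ_k be a Minkowski sum decomposition of a reflexive polytope Δ ⊂ ℝ^d into lattice polytopes. Define Δ̂_0 = Conv(Δ_0, Δ_1 + e_1, …, Δ_k + e_k) ⊂ ℝ^d ⊕ ℝ^k and Δ̂_i = Δ̂_0 − e_i for i = 1,…,k. Then Δ̂_0 + Δ̂_1 + ⋯ + Δ̂_k = (k+1)Δ̂_0 + e_0 is a reflexive polytope in ℝ^d ⊕ ℝ^k with respect to the lattice ℤ^d ⊕ ℤ^k, and its dual reflexive polytope is (Δ̂_0 + ⋯ + Δ̂_k)* = Conv({u − Σ_{i=0}^k min⟨Δ_i,u⟩ e_i* : u ∈ Δ*} ∪ {e_0*, e_1*, …, e_k*}). -/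

import Mathlib

open scoped Pointwise
open Set

noncomputable section

/-- The standard pairing on `ℝ^n`. -/
def pairing {n : ℕ} (x y : Fin n → ℝ) : ℝ := ∑ i, x i * y i

/-- A point of `ℝ^n` lying in the lattice `ℤ^n`. -/
def IsLatticePt {n : ℕ} (x : Fin n → ℝ) : Prop := ∀ i, ∃ z : ℤ, x i = (z : ℝ)

/-- A lattice polytope: the convex hull of finitely many lattice points. -/
def IsLatticePolytope {n : ℕ} (P : Set (Fin n → ℝ)) : Prop :=
  ∃ S : Set (Fin n → ℝ), S.Finite ∧ (∀ x ∈ S, IsLatticePt x) ∧ P = convexHull ℝ S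

/-- The dual polytope `P* = {y | ⟨x,y⟩ ≥ -1 ∀ x ∈ P}`. -/
def polarDual {n : ℕ} (P : Set (Fin n → ℝ)) : Set (Fin n → ℝ) :=
  {y | ∀ x ∈ P, -1 ≤ pairing x y}

/-- A reflexive polytope. -/
def IsReflexive {n : ℕ} (P : Set (Fin n → ℝ)) : Prop :=
  IsLatticePolytope P ∧ (0 : Fin n → ℝ) ∈ interior P ∧ IsLatticePolytope (polarDual P)

/-- `min⟨P, u⟩ = min_{x ∈ P} ⟨x, u⟩`. -/
def minPair {n : ℕ} (P : Set (Fin n → ℝ)) (u : Fin n → ℝ) : ℝ :=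
  sInf ((fun x => pairing x u) '' P)

/-- The real vector space `ℝ^d ⊕ ℝ^k`. -/
abbrev Vdk (d k : ℕ) := (Fin d → ℝ) × (Fin k → ℝ)

/-- The pairing on `ℝ^d ⊕ ℝ^k` (sum of the two standard pairings). -/
def pairingV {d k : ℕ} (x y : Vdk d k) : ℝ := pairing x.1 y.1 + pairing x.2 y.2

def IsLatticePtV {d k : ℕ} (x : Vdk d k) : Prop := IsLatticePt x.1 ∧ IsLatticePt x.2

def IsLatticePolytopeV {d k : ℕ} (P : Set (Vdk d k)) : Prop :=
  ∃ S : Set (Vdk d k), S.Finite ∧ (∀ x ∈ S, IsLatticePtV x) ∧ P = convexHull ℝ S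

def polarDualV {d k : ℕ} (P : Set (Vdk d k)) : Set (Vdk d k) :=
  {y | ∀ x ∈ P, -1 ≤ pairingV x y}

def IsReflexiveV {d k : ℕ} (P : Set (Vdk d k)) : Prop :=
  IsLatticePolytopeV P ∧ (0 : Vdk d k) ∈ interior P ∧ IsLatticePolytopeV (polarDualV P)

/-- The Cayley cone `σ̄ = {(t₀Δ₀ + ⋯ + t_kΔ_k, t₀, …, t_k) : tᵢ ≥ 0} ⊆ ℝ^d ⊕ ℝ^{k+1}`. -/
def cayleyCone {d k : ℕ} (Δ : Fin (k+1) → Set (Fin d → ℝ)) : Set (Vdk d (k+1)) :=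
  {p | (∀ i, 0 ≤ p.2 i) ∧ p.1 ∈ ∑ i, p.2 i • Δ i}

/-- The dual cone of a cone in `ℝ^d ⊕ ℝ^k`. -/
def dualConeV {d k : ℕ} (σ : Set (Vdk d k)) : Set (Vdk d k) :=
  {y | ∀ x ∈ σ, 0 ≤ pairingV x y}

/-- `e₀* = −(e₁* + ⋯ + e_k*)`, `eᵢ*` the standard basis of the second factor `ℝ^k`. -/
def estar {k : ℕ} : Fin (k+1) → Fin k → ℝ :=
  Fin.cases (fun _ => -1) (fun i => Pi.single i 1)

/-! ### The pairing -/

lemma pairing_eq_dotProduct {n : ℕ} (x y : Fin n → ℝ) : pairing x y = x ⬝ᵥ y := rfl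

lemma pairing_sum_left {n : ℕ} {ι : Type*} [Fintype ι] (x : ι → Fin n → ℝ) (y : Fin n → ℝ) :
    pairing (∑ i, x i) y = ∑ i, pairing (x i) y := by
  simp only [pairing_eq_dotProduct, sum_dotProduct]

lemma isLatticePt_sum {n : ℕ} {ι : Type*} [Fintype ι] {x : ι → Fin n → ℝ}
    (h : ∀ i, IsLatticePt (x i)) : IsLatticePt (∑ i, x i) := by
  intro j
  choose z hz using fun i => h i j
  exact ⟨∑ i, z i, by simp [hz]⟩

lemma IsLatticePt.neg {n : ℕ} {x : Fin n → ℝ} (h : IsLatticePt x) : IsLatticePt (-x) := by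
  intro j
  obtain ⟨z, hz⟩ := h j
  exact ⟨-z, by simp [hz]⟩

lemma IsLatticePt.int_smul {n : ℕ} {x : Fin n → ℝ} (h : IsLatticePt x) (a : ℤ) :
    IsLatticePt ((a : ℝ) • x) := by
  intro j
  obtain ⟨z, hz⟩ := h j
  exact ⟨a * z, by simp [hz]⟩

lemma IsLatticePt.add {n : ℕ} {x y : Fin n → ℝ} (hx : IsLatticePt x) (hy : IsLatticePt y) :
    IsLatticePt (x + y) := by
  intro j
  obtain ⟨a, ha⟩ := hx j
  obtain ⟨b, hb⟩ := hy j
  exact ⟨a + b, by simp [ha, hb]⟩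

lemma IsLatticePt.exists_pairing_eq {n : ℕ} {x y : Fin n → ℝ} (hx : IsLatticePt x)
    (hy : IsLatticePt y) : ∃ z : ℤ, pairing x y = z := by
  choose a ha using hx
  choose b hb using hy
  exact ⟨∑ i, a i * b i, by simp [pairing, ha, hb]⟩

lemma IsLatticePolytope.convex {n : ℕ} {P : Set (Fin n → ℝ)} (h : IsLatticePolytope P) :
    Convex ℝ P := by
  obtain ⟨S, -, -, rfl⟩ := h
  exact convex_convexHull ℝ S

/-! ### Minima over lattice polytopes -/

lemma minPair_eq {n : ℕ} {P : Set (Fin n → ℝ)} {u x : Fin n → ℝ} (hx : x ∈ P)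
    (h : ∀ y ∈ P, pairing x u ≤ pairing y u) : minPair P u = pairing x u :=
  IsLeast.csInf_eq ⟨mem_image_of_mem _ hx, forall_mem_image.2 h⟩

lemma IsLatticePolytope.exists_minimizer {n : ℕ} {P : Set (Fin n → ℝ)}
    (hP : IsLatticePolytope P) (hne : P.Nonempty) (u : Fin n → ℝ) :
    ∃ x ∈ P, IsLatticePt x ∧ (∀ y ∈ P, pairing x u ≤ pairing y u) ∧
      minPair P u = pairing x u := by
  obtain ⟨S, hS, hl, rfl⟩ := hP
  obtain ⟨x, hxS, hx⟩ := S.exists_min_image (fun x => pairing x u) hS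
    (convexHull_nonempty_iff.1 hne)
  have hmin : ∀ y ∈ convexHull ℝ S, pairing x u ≤ pairing y u := by
    refine convexHull_min (t := {y | pairing x u ≤ pairing y u}) hx
      fun a ha b hb s t hs ht hst => ?_
    simp only [mem_ofPred_eq, pairing_eq_dotProduct, add_dotProduct, smul_dotProduct,
      smul_eq_mul] at *
    obtain rfl : t = 1 - s := by linarith
    nlinarith
  exact ⟨x, subset_convexHull ℝ S hxS, hl x hxS, hmin,
    minPair_eq (subset_convexHull ℝ S hxS) hmin⟩

lemma minPair_smul {n : ℕ} {P : Set (Fin n → ℝ)} (hP : IsLatticePolytope P)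
    (hne : P.Nonempty) {c : ℝ} (hc : 0 ≤ c) (u : Fin n → ℝ) :
    minPair P (c • u) = c * minPair P u := by
  obtain ⟨x, hx, -, hmin, he⟩ := hP.exists_minimizer hne u
  have key : ∀ y, pairing y (c • u) = c * pairing y u := fun y => by
    simp [pairing_eq_dotProduct]
  rw [he, ← key]
  refine minPair_eq hx fun y hy => ?_
  rw [key, key]
  exact mul_le_mul_of_nonneg_left (hmin y hy) hc

lemma minPair_le {n : ℕ} {P : Set (Fin n → ℝ)} (hP : IsLatticePolytope P)
    {x : Fin n → ℝ} (hx : x ∈ P) (u : Fin n → ℝ) : minPair P u ≤ pairing x u := by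
  obtain ⟨z, -, -, hmin, he⟩ := hP.exists_minimizer ⟨x, hx⟩ u
  exact he ▸ hmin x hx

lemma mem_polarDual_sum_iff {n : ℕ} {ι : Type*} [Fintype ι] {Δ : ι → Set (Fin n → ℝ)}
    (hlat : ∀ i, IsLatticePolytope (Δ i)) (hne : ∀ i, (Δ i).Nonempty) (u : Fin n → ℝ) :
    u ∈ polarDual (∑ i, Δ i) ↔ -1 ≤ ∑ i, minPair (Δ i) u := by
  constructor
  · intro h
    choose x hx _ _ he using fun i => (hlat i).exists_minimizer (hne i) u
    have := h (∑ i, x i) (Set.mem_fintype_sum _ _ |>.2 ⟨x, hx, rfl⟩)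
    simpa [he, pairing_sum_left] using this
  · rintro h x hx
    obtain ⟨y, hy, rfl⟩ := (Set.mem_fintype_sum _ _).1 hx
    rw [pairing_sum_left]
    exact h.trans (Finset.sum_le_sum fun i _ => minPair_le (hlat i) (hy i) u)

lemma eq_zero_of_pairing_nonneg {n : ℕ} {P : Set (Fin n → ℝ)} (h0 : 0 ∈ interior P)
    {u : Fin n → ℝ} (hu : ∀ x ∈ P, 0 ≤ pairing x u) : u = 0 := by
  have hc : Filter.Tendsto (fun c : ℝ => -(c • u)) (nhdsWithin 0 (Ioi 0)) (nhds 0) := by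
    have : Continuous fun c : ℝ => -(c • u) := by fun_prop
    exact (this.tendsto' 0 0 (by simp)).mono_left nhdsWithin_le_nhds
  obtain ⟨c, hcP, hc0⟩ := ((hc.eventually (mem_interior_iff_mem_nhds.1 h0)).and
    self_mem_nhdsWithin).exists
  have h := hu _ hcP
  simp only [pairing_eq_dotProduct, neg_dotProduct, smul_dotProduct, smul_eq_mul] at h
  have hc0 : 0 < c := hc0
  have hnn : 0 ≤ u ⬝ᵥ u := by
    simpa using dotProduct_star_self_nonneg u
  have : u ⬝ᵥ u = 0 := by nlinarith
  exact dotProduct_self_eq_zero.1 this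

/-! ### The vectors `0, e₁, …, e_k` and their duals -/

/-- The vertices `0, e₁, …, e_k` of the standard simplex. -/
def simplexVertex {k : ℕ} : Fin (k + 1) → Fin k → ℝ :=
  Fin.cases 0 (fun i => Pi.single i 1)

/-- The value of `(0, v)` on the `i`-th group of vertices of `(k + 1) Δ̂₀ + e₀`. -/
def vertexValue {k : ℕ} (i : Fin (k + 1)) (v : Fin k → ℝ) : ℝ :=
  (k + 1) * pairing (simplexVertex i) v + pairing (fun _ => -1) v

lemma pairing_simplexVertex_zero {k : ℕ} (v : Fin k → ℝ) :
    pairing (simplexVertex 0) v = 0 := by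
  simp [pairing, simplexVertex]

lemma pairing_simplexVertex_succ {k : ℕ} (i : Fin k) (v : Fin k → ℝ) :
    pairing (simplexVertex i.succ) v = v i := by
  simp [pairing_eq_dotProduct, simplexVertex]

lemma pairing_neg_one {k : ℕ} (v : Fin k → ℝ) : pairing (fun _ => -1) v = -∑ i, v i := by
  simp [pairing]

lemma vertexValue_zero {k : ℕ} (v : Fin k → ℝ) : vertexValue 0 v = -∑ i, v i := by
  simp [vertexValue, pairing_simplexVertex_zero, pairing_neg_one]

lemma vertexValue_succ {k : ℕ} (i : Fin k) (v : Fin k → ℝ) :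
    vertexValue i.succ v = (k + 1) * v i - ∑ i, v i := by
  simp [vertexValue, pairing_simplexVertex_succ, pairing_neg_one, sub_eq_add_neg]

lemma sum_vertexValue {k : ℕ} (v : Fin k → ℝ) : ∑ i, vertexValue i v = 0 := by
  simp only [Fin.sum_univ_succ, vertexValue_zero, vertexValue_succ, Finset.sum_sub_distrib,
    ← Finset.mul_sum]
  simp
  ring

lemma vertexValue_neg_sum {k : ℕ} (i : Fin (k + 1)) (c : Fin (k + 1) → ℝ)
    (w : Fin (k + 1) → Fin k → ℝ) :
    vertexValue i (-∑ j, c j • w j) = -∑ j, c j * vertexValue i (w j) := by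
  simp only [vertexValue, pairing_eq_dotProduct, dotProduct_neg, dotProduct_sum,
    dotProduct_smul, smul_eq_mul, mul_add, Finset.sum_add_distrib, mul_left_comm _ ((k : ℝ) + 1),
    ← Finset.mul_sum]
  ring

lemma vertexValue_estar {k : ℕ} (i j : Fin (k + 1)) :
    vertexValue i (estar j) = (k + 1) * (if i = j then 1 else 0) - 1 := by
  refine Fin.cases ?_ (fun i => ?_) i <;> refine Fin.cases ?_ (fun j => ?_) j
  · simp [vertexValue_zero, estar]
  · simp [vertexValue_zero, estar, (Fin.succ_ne_zero j).symm]
  · simp [vertexValue_succ, estar, Fin.succ_ne_zero]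
  · simp [vertexValue_succ, estar, Pi.single_apply]

lemma sum_smul_estar_apply {k : ℕ} (c : Fin (k + 1) → ℝ) (j : Fin k) :
    (∑ i, c i • estar i : Fin k → ℝ) j = c j.succ - c 0 := by
  simp [Fin.sum_univ_succ, estar, Pi.single_apply]
  ring

lemma sum_smul_simplexVertex_apply {k : ℕ} (c : Fin (k + 1) → ℝ) (j : Fin k) :
    (∑ i, c i • simplexVertex i : Fin k → ℝ) j = c j.succ := by
  simp [Fin.sum_univ_succ, simplexVertex, Pi.single_apply]

lemma isLatticePt_simplexVertex {k : ℕ} (i : Fin (k + 1)) :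
    IsLatticePt (simplexVertex i : Fin k → ℝ) := by
  refine Fin.cases (fun j => ⟨0, by simp [simplexVertex]⟩) (fun i j => ?_) i
  exact ⟨if j = i then 1 else 0, by simp [simplexVertex, Pi.single_apply]⟩

lemma isLatticePt_estar {k : ℕ} (i : Fin (k + 1)) : IsLatticePt (estar i : Fin k → ℝ) := by
  refine Fin.cases (fun j => ⟨-1, by simp [estar]⟩) (fun i j => ?_) i
  exact ⟨if j = i then 1 else 0, by simp [estar, Pi.single_apply]⟩

/-! ### The Cayley polytope and its translates -/

lemma sum_translates_eq {V : Type*} [AddCommGroup V] [Module ℝ V] {Q : Set V}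
    (hQ : Convex ℝ Q) (n : ℕ) (c : Fin (n + 1) → V) :
    ∑ i, (fun y => y + c i) '' Q = (fun y => y + ∑ i, c i) '' (((n : ℝ) + 1) • Q) := by
  simp only [← Set.add_singleton]
  induction n with
  | zero => simp
  | succ n ih =>
    rw [Fin.sum_univ_castSucc, ih, Fin.sum_univ_castSucc c, Nat.cast_succ,
      hQ.add_smul (p := (n : ℝ) + 1) (by positivity) zero_le_one, one_smul,
      ← Set.singleton_add_singleton, add_add_add_comm]

/-- The polytope `Δ̂₀ = Conv(Δ₀, Δ₁ + e₁, …, Δ_k + e_k)`. -/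
def cayleyPolytope {d k : ℕ} (Δ : Fin (k + 1) → Set (Fin d → ℝ)) : Set (Vdk d k) :=
  convexHull ℝ (⋃ i, (fun x => (x, simplexVertex i)) '' Δ i)

/-- The polytope `(k + 1) Δ̂₀ + e₀`. -/
def shiftedCayley {d k : ℕ} (Δ : Fin (k + 1) → Set (Fin d → ℝ)) : Set (Vdk d k) :=
  (fun y => y + ((0 : Fin d → ℝ), fun _ => -1)) '' (((k : ℝ) + 1) • cayleyPolytope Δ)

/-- The map `u ↦ u − ∑ᵢ min⟨Δᵢ, u⟩ eᵢ*`. -/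
def dualLift {d k : ℕ} (Δ : Fin (k + 1) → Set (Fin d → ℝ)) (u : Fin d → ℝ) : Vdk d k :=
  (u, -(∑ i, minPair (Δ i) u • estar i))

lemma convex_polarDualV {d k : ℕ} (P : Set (Vdk d k)) : Convex ℝ (polarDualV P) := by
  intro a ha b hb s t hs ht hst x hx
  have h1 := mul_le_mul_of_nonneg_left (ha x hx) hs
  have h2 := mul_le_mul_of_nonneg_left (hb x hx) ht
  simp only [pairingV, pairing_eq_dotProduct, Prod.fst_add, Prod.snd_add, Prod.smul_fst,
    Prod.smul_snd, dotProduct_add, dotProduct_smul, smul_eq_mul] at *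
  nlinarith

lemma mem_polarDualV_shiftedCayley_iff {d k : ℕ} (Δ : Fin (k + 1) → Set (Fin d → ℝ))
    (y : Vdk d k) : y ∈ polarDualV (shiftedCayley Δ) ↔
      ∀ i, ∀ x ∈ Δ i, -1 ≤ (k + 1) * pairing x y.1 + vertexValue i y.2 := by
  have key : ∀ q : Vdk d k,
      pairingV (((k : ℝ) + 1) • q + ((0 : Fin d → ℝ), fun _ => -1)) y =
        (k + 1) * pairingV q y + pairing (fun _ => -1) y.2 := fun q => by
    simp only [pairingV, pairing_eq_dotProduct, Prod.fst_add, Prod.snd_add, Prod.smul_fst,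
      Prod.smul_snd, add_dotProduct, smul_dotProduct, smul_eq_mul, zero_dotProduct]
    ring
  have key' : y ∈ polarDualV (shiftedCayley Δ) ↔ ∀ q ∈ cayleyPolytope Δ,
      -1 ≤ (k + 1) * pairingV q y + pairing (fun _ => -1) y.2 := by
    simp only [polarDualV, shiftedCayley, mem_ofPred_eq, forall_mem_image, ← key]
    exact forall_mem_image (f := fun q : Vdk d k => ((k : ℝ) + 1) • q)
  rw [key']
  constructor
  · intro h i x hx
    have := h (x, simplexVertex i) (subset_convexHull ℝ _ (mem_iUnion.2 ⟨i, x, hx, rfl⟩))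
    simp only [pairingV, vertexValue] at this ⊢
    linarith
  · intro h
    refine convexHull_min (t := {q | -1 ≤ (k + 1) * pairingV q y + pairing (fun _ => -1) y.2})
      (iUnion_subset fun i => ?_) fun a ha b hb s t hs ht hst => ?_
    · rintro _ ⟨x, hx, rfl⟩
      have := h i x hx
      simp only [mem_ofPred_eq, pairingV, vertexValue] at this ⊢
      linarith
    · have h1 := mul_le_mul_of_nonneg_left (mem_ofPred.1 ha) hs
      have h2 := mul_le_mul_of_nonneg_left (mem_ofPred.1 hb) ht
      have hab : pairingV (s • a + t • b) y = s * pairingV a y + t * pairingV b y := by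
        simp only [pairingV, pairing_eq_dotProduct, Prod.fst_add, Prod.snd_add, Prod.smul_fst,
          Prod.smul_snd, add_dotProduct, smul_dotProduct, smul_eq_mul]
        ring
      rw [mem_ofPred_eq, hab]
      obtain rfl : t = 1 - s := by linarith
      nlinarith

lemma isLatticePolytopeV_shiftedCayley {d k : ℕ} {Δ : Fin (k + 1) → Set (Fin d → ℝ)}
    (hlat : ∀ i, IsLatticePolytope (Δ i)) : IsLatticePolytopeV (shiftedCayley Δ) := by
  choose S hfin hl hS using hlat
  have hcay : cayleyPolytope Δ =
      convexHull ℝ (⋃ i, (fun x => (x, simplexVertex i)) '' S i) := by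
    refine (convexHull_min (iUnion_subset fun i => ?_) (convex_convexHull ℝ _)).antisymm
      (convexHull_mono (iUnion_mono fun i => image_mono (hS i ▸ subset_convexHull ℝ _)))
    have hprod : (fun x => ((x, simplexVertex i) : Vdk d k)) '' Δ i =
        convexHull ℝ ((fun x => ((x, simplexVertex i) : Vdk d k)) '' S i) := by
      simp only [← Set.prod_singleton, convexHull_prod, convexHull_singleton, hS i]
    rw [hprod]
    exact convexHull_mono (subset_iUnion_of_subset i subset_rfl)
  refine ⟨(fun y => y + ((0 : Fin d → ℝ), fun _ => -1)) '' (((k : ℝ) + 1) •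
    ⋃ i, (fun x => ((x, simplexVertex i) : Vdk d k)) '' S i), ?_, ?_, ?_⟩
  · exact ((finite_iUnion fun i => (hfin i).image _).image _).image _
  · rintro _ ⟨_, ⟨p, hp, rfl⟩, rfl⟩
    obtain ⟨i, x, hx, rfl⟩ := mem_iUnion.1 hp
    have h1 := (hl i x hx).int_smul (k + 1)
    have h2 := ((isLatticePt_simplexVertex i).int_smul (k + 1)).add
      (y := fun _ : Fin k => (-1 : ℝ)) fun _ => ⟨-1, by simp⟩
    push_cast at h1 h2
    exact ⟨by simpa using h1, h2⟩
  · simp only [shiftedCayley, hcay, ← Set.add_singleton, convexHull_add, convexHull_smul,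
      convexHull_singleton]

lemma zero_mem_interior_shiftedCayley {d k : ℕ} {Δ : Fin (k + 1) → Set (Fin d → ℝ)}
    (hconv : ∀ i, Convex ℝ (Δ i)) (h0 : 0 ∈ interior (∑ i, Δ i)) :
    0 ∈ interior (shiftedCayley Δ) := by
  obtain ⟨a, ha, ha0⟩ := (Set.mem_fintype_sum _ _).1 (interior_subset h0)
  let c : (Fin k → ℝ) → Fin (k + 1) → ℝ := fun q =>
    Fin.cases (1 - ∑ i, q i) (fun i => 1 + q i)
  have hc : ∀ i, Continuous fun q => c q i := by
    refine Fin.cases ?_ fun i => ?_ <;> simp only [c, Fin.cases_zero, Fin.cases_succ] <;> fun_prop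
  have hc0 : ∀ i, c 0 i = 1 := Fin.cases (by simp [c]) fun i => by simp [c]
  have hcsum : ∀ q, ∑ i, c q i = k + 1 := fun q => by
    simp [Fin.sum_univ_succ, c, Finset.sum_add_distrib]
    ring
  have hpos : ∀ᶠ z : Vdk d k in nhds 0, ∀ i, 1 / 2 < c z.2 i := by
    refine Filter.eventually_all.2 fun i => ?_
    have : Continuous fun z : Vdk d k => c z.2 i := (hc i).comp continuous_snd
    exact this.continuousAt.eventually (lt_mem_nhds (by simp [hc0]; norm_num))
  have hmem : ∀ᶠ z : Vdk d k in nhds 0,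
      (2 : ℝ) • (z.1 - ∑ i, (c z.2 i - 1 / 2) • a i) ∈ ∑ i, Δ i := by
    have : Continuous fun z : Vdk d k =>
        (2 : ℝ) • (z.1 - ∑ i, (c z.2 i - 1 / 2) • a i) := by
      have := fun i => (hc i).comp (continuous_snd (X := Fin d → ℝ))
      simp only [Function.comp_def] at this
      fun_prop
    refine (this.tendsto' 0 0 ?_).eventually (mem_interior_iff_mem_nhds.1 h0)
    simp [hc0, ← Finset.smul_sum, ha0]
  rw [mem_interior_iff_mem_nhds]
  filter_upwards [hpos, hmem] with z hz hzΔ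
  obtain ⟨y, hy, hyz⟩ := (Set.mem_fintype_sum _ _).1 hzΔ
  have hx : ∀ i, ∃ x ∈ Δ i, c z.2 i • x = (1 / 2 : ℝ) • y i + (c z.2 i - 1 / 2) • a i := by
    intro i
    have h := Set.add_mem_add (smul_mem_smul_set (a := (1 / 2 : ℝ)) (hy i))
      (smul_mem_smul_set (a := c z.2 i - 1 / 2) (ha i))
    rw [← (hconv i).add_smul (by norm_num) (by linarith [hz i]), add_sub_cancel] at h
    exact h
  choose x hxΔ hx using hx
  have hk : (0 : ℝ) < k + 1 := by positivity
  have hsum : ∑ i, c z.2 i • x i = z.1 := by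
    simp only [hx, Finset.sum_add_distrib, ← Finset.smul_sum (r := (1 / 2 : ℝ)), hyz, smul_smul]
    norm_num
  refine ⟨_, smul_mem_smul_set (a := (k : ℝ) + 1) (b := ∑ i, (c z.2 i / (k + 1)) •
    ((x i, simplexVertex i) : Vdk d k)) ?_, ?_⟩
  · refine (convex_convexHull ℝ _).sum_mem (fun i _ => ?_) ?_ fun i _ =>
      subset_convexHull ℝ _ (mem_iUnion.2 ⟨i, x i, hxΔ i, rfl⟩)
    · exact div_nonneg (by linarith [hz i]) hk.le
    · rw [← Finset.sum_div, hcsum, div_self hk.ne']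
  · simp only [Finset.smul_sum, smul_smul, mul_div_cancel₀ _ hk.ne']
    ext j
    · simp [← hsum, Prod.fst_sum]
    · have := sum_smul_simplexVertex_apply (c z.2) j
      simp only [Finset.sum_apply, Pi.smul_apply] at this
      simp [Prod.snd_sum, -smul_eq_mul, this, c]

/-! ### The dual polytope -/

lemma smul_dualLift {d k : ℕ} {Δ : Fin (k + 1) → Set (Fin d → ℝ)}
    (hlat : ∀ i, IsLatticePolytope (Δ i)) (hne : ∀ i, (Δ i).Nonempty) {t : ℝ} (ht : 0 ≤ t)
    (u : Fin d → ℝ) : dualLift Δ (t • u) = t • dualLift Δ u := by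
  simp only [dualLift, minPair_smul (hlat _) (hne _) ht, Prod.smul_mk, smul_neg,
    Finset.smul_sum, smul_smul]

lemma isLatticePtV_dualLift {d k : ℕ} {Δ : Fin (k + 1) → Set (Fin d → ℝ)}
    (hlat : ∀ i, IsLatticePolytope (Δ i)) (hne : ∀ i, (Δ i).Nonempty) {u : Fin d → ℝ}
    (hu : IsLatticePt u) : IsLatticePtV (dualLift Δ u) := by
  refine ⟨hu, (isLatticePt_sum fun i => ?_).neg⟩
  obtain ⟨x, -, hx, -, he⟩ := (hlat i).exists_minimizer (hne i) u
  obtain ⟨z, hz⟩ := hx.exists_pairing_eq hu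
  rw [he, hz]
  exact (isLatticePt_estar i).int_smul z

lemma dualLift_mem_polarDualV {d k : ℕ} {Δ : Fin (k + 1) → Set (Fin d → ℝ)}
    (hlat : ∀ i, IsLatticePolytope (Δ i)) (hne : ∀ i, (Δ i).Nonempty) {u : Fin d → ℝ}
    (hu : u ∈ polarDual (∑ i, Δ i)) : dualLift Δ u ∈ polarDualV (shiftedCayley Δ) := by
  rw [mem_polarDual_sum_iff hlat hne] at hu
  refine (mem_polarDualV_shiftedCayley_iff Δ _).2 fun i x hx => ?_
  have h := minPair_le (hlat i) hx u
  simp only [dualLift, vertexValue_neg_sum, vertexValue_estar, mul_sub, Finset.sum_sub_distrib]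
  simp
  have hk : (0 : ℝ) ≤ k + 1 := by positivity
  nlinarith [mul_le_mul_of_nonneg_left h hk]

lemma estar_mem_polarDualV {d k : ℕ} {Δ : Fin (k + 1) → Set (Fin d → ℝ)} (j : Fin (k + 1)) :
    ((0, estar j) : Vdk d k) ∈ polarDualV (shiftedCayley Δ) := by
  refine (mem_polarDualV_shiftedCayley_iff Δ _).2 fun i x hx => ?_
  have hk : (0 : ℝ) ≤ k + 1 := by positivity
  simp only [vertexValue_estar, pairing_eq_dotProduct, dotProduct_zero]
  split_ifs <;> linarith

/-- `dualLift` is affine on the faces of the dual polytope that do not contain the origin. -/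
lemma dualLift_mem_convexHull {d k : ℕ} {Δ : Fin (k + 1) → Set (Fin d → ℝ)}
    (hlat : ∀ i, IsLatticePolytope (Δ i)) (hne : ∀ i, (Δ i).Nonempty) {T : Set (Fin d → ℝ)}
    (hT : polarDual (∑ i, Δ i) = convexHull ℝ T) {u : Fin d → ℝ}
    (hu : ∑ i, minPair (Δ i) u = -1) : dualLift Δ u ∈ convexHull ℝ (dualLift Δ '' T) := by
  have huT : u ∈ convexHull ℝ T := hT ▸ (mem_polarDual_sum_iff hlat hne u).2 hu.ge
  obtain ⟨ι, _, c, z, hc0, hc1, hz, hcz⟩ := mem_convexHull_iff_exists_fintype.1 huT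
  choose x hx _ _ he using fun i => (hlat i).exists_minimizer (hne i) u
  have hpair : ∀ y, pairing y u = ∑ j, c j * pairing y (z j) := fun y => by
    simp [← hcz, pairing_eq_dotProduct, dotProduct_sum]
  have hle : ∀ j i, minPair (Δ i) (z j) ≤ pairing (x i) (z j) := fun j i =>
    minPair_le (hlat i) (hx i) _
  have hge : ∀ j, -1 ≤ ∑ i, minPair (Δ i) (z j) := fun j =>
    (mem_polarDual_sum_iff hlat hne _).1 (hT ▸ subset_convexHull ℝ T (hz j))
  have hsum : ∑ j, c j * (∑ i, pairing (x i) (z j) + 1) = 0 := by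
    simp only [mul_add, Finset.sum_add_distrib, mul_one, hc1, Finset.mul_sum]
    rw [Finset.sum_comm]
    simp only [← hpair, ← he, hu]
    norm_num
  have hnn : ∀ j, 0 ≤ ∑ i, pairing (x i) (z j) + 1 := fun j => by
    linarith [hge j, Finset.sum_le_sum fun i (_ : i ∈ Finset.univ) => hle j i]
  have hzero := (Finset.sum_eq_zero_iff_of_nonneg fun j _ =>
    mul_nonneg (hc0 j) (hnn j)).1 hsum
  have heq : ∀ j i, c j * pairing (x i) (z j) = c j * minPair (Δ i) (z j) := by
    intro j i
    rcases mul_eq_zero.1 (hzero j (Finset.mem_univ j)) with h | h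
    · simp [h]
    · have hs : ∑ i, minPair (Δ i) (z j) = ∑ i, pairing (x i) (z j) :=
        (Finset.sum_le_sum fun i _ => hle j i).antisymm (by linarith [hge j])
      rw [(Finset.sum_eq_sum_iff_of_le fun i _ => hle j i).1 hs i (Finset.mem_univ i)]
  have hlift : dualLift Δ u = ∑ j, c j • dualLift Δ (z j) := by
    refine Prod.ext ?_ ?_
    · simp [dualLift, Prod.fst_sum, hcz]
    · simp only [dualLift, Prod.snd_sum, Prod.smul_snd, smul_neg, Finset.sum_neg_distrib,
        Finset.smul_sum, smul_smul, ← heq]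
      rw [Finset.sum_comm]
      simp only [← Finset.sum_smul, ← hpair, he]
  rw [hlift]
  exact (convex_convexHull ℝ _).sum_mem (fun j _ => hc0 j) hc1 fun j _ =>
    subset_convexHull ℝ _ (mem_image_of_mem _ (hz j))

lemma polarDualV_shiftedCayley_subset {d k : ℕ} {Δ : Fin (k + 1) → Set (Fin d → ℝ)}
    (hlat : ∀ i, IsLatticePolytope (Δ i)) (hne : ∀ i, (Δ i).Nonempty)
    (h0 : 0 ∈ interior (∑ i, Δ i)) {T : Set (Fin d → ℝ)}
    (hT : polarDual (∑ i, Δ i) = convexHull ℝ T) :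
    polarDualV (shiftedCayley Δ) ⊆
      convexHull ℝ (dualLift Δ '' T ∪ ⋃ i, {((0 : Fin d → ℝ), estar i)}) := by
  rintro ⟨u, v⟩ huv
  rw [mem_polarDualV_shiftedCayley_iff] at huv
  set H := convexHull ℝ (dualLift Δ '' T ∪ ⋃ i, {((0 : Fin d → ℝ), (estar i : Fin k → ℝ))})
  have hestar : ∀ i, ((0 : Fin d → ℝ), estar i) ∈ H := fun i =>
    subset_convexHull ℝ _ (Or.inr (mem_iUnion.2 ⟨i, rfl⟩))
  have hk : (0 : ℝ) < k + 1 := by positivity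
  set t := -∑ i, minPair (Δ i) u with ht
  have hminle : ∀ x ∈ ∑ i, Δ i, -t ≤ pairing x u := by
    intro x hx
    obtain ⟨y, hy, rfl⟩ := (Set.mem_fintype_sum _ _).1 hx
    rw [ht, neg_neg, pairing_sum_left]
    exact Finset.sum_le_sum fun i _ => minPair_le (hlat i) (hy i) u
  have ht0 : 0 ≤ t := by
    have := hminle 0 (interior_subset h0)
    simp only [pairing_eq_dotProduct, zero_dotProduct] at this
    linarith
  obtain ⟨A, hA, hAt⟩ : ∃ A ∈ H, t • A = dualLift Δ u := by
    rcases ht0.eq_or_lt with h | h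
    · refine ⟨_, hestar 0, ?_⟩
      have hu : u = 0 := eq_zero_of_pairing_nonneg h0 fun x hx => by
        linarith [hminle x hx]
      rw [hu, ← zero_smul ℝ (0 : Fin d → ℝ), smul_dualLift hlat hne le_rfl, ← h, zero_smul,
        zero_smul]
    · refine ⟨dualLift Δ (t⁻¹ • u), convexHull_mono subset_union_left
        (dualLift_mem_convexHull hlat hne hT ?_), ?_⟩
      · simp only [minPair_smul (hlat _) (hne _) (inv_nonneg.2 ht0), ← Finset.mul_sum]
        rw [← neg_neg (∑ i, minPair (Δ i) u), ← ht, mul_neg, inv_mul_cancel₀ h.ne']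
      · rw [← smul_dualLift hlat hne ht0, smul_smul, mul_inv_cancel₀ h.ne', one_smul]
  let w : Fin (k + 1) → ℝ := fun i => minPair (Δ i) u + (vertexValue i v + 1) / (k + 1)
  have hw0 : ∀ i, 0 ≤ w i := by
    intro i
    obtain ⟨x, hx, -, -, he⟩ := (hlat i).exists_minimizer (hne i) u
    have := huv i x hx
    simp only [w, he]
    have h2 : pairing x u + (vertexValue i v + 1) / (k + 1) =
        ((k + 1) * pairing x u + vertexValue i v + 1) / (k + 1) := by
      field_simp
      ring
    rw [h2]
    exact div_nonneg (by linarith) hk.le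
  have hw1 : t + ∑ i, w i = 1 := by
    simp only [w, Finset.sum_add_distrib, ← Finset.sum_div, sum_vertexValue]
    simp [ht, div_self hk.ne']
  have hdecomp : ((u, v) : Vdk d k) = t • A + ∑ i, w i • ((0 : Fin d → ℝ), estar i) := by
    rw [hAt]
    refine Prod.ext ?_ ?_
    · simp [dualLift, Prod.fst_sum]
    · ext j
      simp only [dualLift, Prod.snd_add, Prod.snd_sum, Prod.smul_snd, Pi.add_apply, Pi.neg_apply,
        sum_smul_estar_apply, w, vertexValue_succ, vertexValue_zero]
      field_simp
      ring
  rw [hdecomp]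
  have := (convex_convexHull ℝ _ : Convex ℝ H).sum_mem (t := Finset.univ)
    (w := fun o : Option (Fin (k + 1)) => o.elim t w)
    (z := fun o => o.elim A fun i => ((0 : Fin d → ℝ), estar i))
    (by rintro (_ | i) - <;> simp [ht0, hw0]) (by simpa [Fintype.sum_option] using hw1)
    (by rintro (_ | i) - 
        exacts [hA, hestar i])
  rw [Fintype.sum_option] at this
  exact this

/-- `Δ̂₀ + ⋯ + Δ̂_k = (k+1)Δ̂₀ + e₀` is a reflexive polytope in
`ℝ^d ⊕ ℝ^k` whose dual is `Conv({u − Σᵢ₌₀ᵏ min⟨Δᵢ,u⟩eᵢ* : u ∈ Δ*} ∪ {e₀*, …, e_k*})`. -/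
theorem hatDelta_sum_reflexive {d k : ℕ}
    (Δ : Fin (k+1) → Set (Fin d → ℝ))
    (hlat : ∀ i, IsLatticePolytope (Δ i))
    (hrefl : IsReflexive (∑ i, Δ i))
    -- Δ̂₀ = Conv(Δ₀, Δ₁ + e₁, …, Δ_k + e_k)
    (Q : Set (Vdk d k))
    (hQ : Q = convexHull ℝ ((fun x => ((x, 0) : Vdk d k)) '' Δ 0 ∪
        ⋃ i : Fin k, (fun x => ((x, Pi.single i 1) : Vdk d k)) '' Δ i.succ))
    -- Δ̂ᵢ = Δ̂₀ − eᵢ for i = 1, …, k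
    (Δhat : Fin (k+1) → Set (Vdk d k))
    (hΔhat : Δhat = Fin.cases Q
        (fun i => (fun y => y - (((0 : Fin d → ℝ), Pi.single i 1) : Vdk d k)) '' Q)) :
    -- Δ̂₀ + Δ̂₁ + ⋯ + Δ̂_k = (k+1)Δ̂₀ + e₀
    (∑ i, Δhat i =
      (fun y => y + (((0 : Fin d → ℝ), fun _ => -1) : Vdk d k)) '' (((k : ℝ) + 1) • Q)) ∧
    -- it is a reflexive polytope w.r.t. the lattice ℤ^d ⊕ ℤ^k
    IsReflexiveV (∑ i, Δhat i) ∧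
    -- its dual reflexive polytope
    polarDualV (∑ i, Δhat i) =
      convexHull ℝ
        ((fun u => ((u, -(∑ i : Fin (k+1), minPair (Δ i) u • estar i)) : Vdk d k)) ''
            polarDual (∑ i, Δ i) ∪
          ⋃ i : Fin (k+1), {(((0 : Fin d → ℝ), estar i) : Vdk d k)}) := by
  obtain ⟨-, h0, T, hTfin, hTlat, hT⟩ := hrefl
  have hne : ∀ i, (Δ i).Nonempty := by
    obtain ⟨a, ha, -⟩ := (Set.mem_fintype_sum _ _).1 (interior_subset h0)
    exact fun i => ⟨a i, ha i⟩
  have hQ' : Q = cayleyPolytope Δ := by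
    rw [hQ, cayleyPolytope]
    congr 1
    ext p
    simp [simplexVertex, Fin.exists_fin_succ]
  have hsum : ∑ i, Δhat i = shiftedCayley Δ := by
    have hhat : Δhat = fun i =>
        (fun y => y + ((0 : Fin d → ℝ), -(simplexVertex i : Fin k → ℝ))) '' Q := by
      rw [hΔhat]
      funext i
      refine Fin.cases ?_ (fun i => ?_) i
      · simp [simplexVertex, ← Prod.zero_eq_mk]
      · simp [simplexVertex, sub_eq_add_neg]
    rw [hhat, sum_translates_eq (hQ' ▸ convex_convexHull ℝ _), shiftedCayley, hQ']
    congr 2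
    funext y
    congr 1
    refine Prod.ext (by simp [Prod.fst_sum]) ?_
    ext j
    have := sum_smul_simplexVertex_apply (fun _ => -1) j
    simpa [Prod.snd_sum] using this
  have hsub := polarDualV_shiftedCayley_subset hlat hne h0 hT
  have hmono : convexHull ℝ (dualLift Δ '' T ∪ ⋃ i, {((0 : Fin d → ℝ), estar i)}) ⊆
      convexHull ℝ (dualLift Δ '' polarDual (∑ i, Δ i) ∪
        ⋃ i, {((0 : Fin d → ℝ), (estar i : Fin k → ℝ))}) :=
    convexHull_mono (union_subset_union_left _ (image_mono (hT ▸ subset_convexHull ℝ T)))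
  have hsup : convexHull ℝ (dualLift Δ '' polarDual (∑ i, Δ i) ∪
      ⋃ i, {((0 : Fin d → ℝ), (estar i : Fin k → ℝ))}) ⊆ polarDualV (shiftedCayley Δ) := by
    refine convexHull_min (union_subset ?_ (iUnion_subset fun i => ?_)) (convex_polarDualV _)
    · rintro _ ⟨u, hu, rfl⟩
      exact dualLift_mem_polarDualV hlat hne hu
    · exact singleton_subset_iff.2 (estar_mem_polarDualV i)
  rw [hsum]
  refine ⟨by rw [hQ', shiftedCayley], ⟨isLatticePolytopeV_shiftedCayley hlat,
    zero_mem_interior_shiftedCayley (fun i => (hlat i).convex) h0, _, ?_, ?_,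
    hsub.antisymm (hmono.trans hsup)⟩, (hsub.trans hmono).antisymm hsup⟩
  · exact (hTfin.image _).union (finite_iUnion fun i => finite_singleton _)
  · rintro _ (⟨u, hu, rfl⟩ | hx)
    · exact isLatticePtV_dualLift hlat hne (hTlat u hu)
    · obtain ⟨i, rfl⟩ := mem_iUnion.1 hx
      exact ⟨fun _ => ⟨0, by simp⟩, isLatticePt_estar i⟩
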